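/- Let D be a function assigning to each pair of finite Borel measures on ℝ² a value in [0,∞] that is jointly convex, i.e., D(λν + (1−λ)ν', λρ + (1−λ)ρ') ≤ λ D(ν,ρ) + (1−λ) D(ν',ρ') for λ ∈ (0,1). Assume assumption (A) and fix r_{s,t,τ} ≥ 0 for (s,t,τ) ∈ Δ. Then the set of r-homogeneous couplings { Q ∈ Π(μ_1,…,μ_T) : D(θ^{s,t} ⊗ K_{s,s+τ}, θ^{s,t} ⊗ K_{t,t+τ}) ≤ r_{s,t,τ} for all (s,t,τ) ∈ Δ } is convex. -/

import Mathlib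

open MeasureTheory ProbabilityTheory
open scoped ENNReal

noncomputable section

/-- The `t`-th one-dimensional marginal of a measure on `ℝ^T`. -/
def marginal {T : ℕ} (Q : Measure (Fin T → ℝ)) (t : Fin T) : Measure ℝ :=
  Q.map (fun x => x t)

/-- The joint law of the coordinates `(s, u)`. -/
def joint {T : ℕ} (Q : Measure (Fin T → ℝ)) (s u : Fin T) : Measure (ℝ × ℝ) :=
  Q.map (fun x => (x s, x u))

/-- `K` is a disintegration kernel of `Q` over the coordinates `(s, u)`:
`Q_{(s,u)} = Q_s ⊗ K`. -/
def IsDisint {T : ℕ} (Q : Measure (Fin T → ℝ)) (s u : Fin T) (K : Kernel ℝ ℝ) : Prop :=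
  IsMarkovKernel K ∧ joint Q s u = (marginal Q s).compProd K

/-- The absolutely continuous part `μ^{ν,abs}` of `μ` with respect to `ν` in the
Lebesgue decomposition. -/
def absPart (μ ν : Measure ℝ) : Measure ℝ := ν.withDensity (μ.rnDeriv ν)

/-- `Q` is homogeneous: for every `(s,t,τ) ∈ Δ`, the disintegration kernels satisfy
`K_{s,s+τ} = K_{t,t+τ}` a.s. with respect to `Q_s ∧ Q_t`, i.e. w.r.t. the absolutely
continuous part of `Q_s` with respect to `Q_t`. -/
def IsHom {T : ℕ} (Q : Measure (Fin T → ℝ)) : Prop :=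
  ∀ (s t : Fin T) (τ : ℕ) (hs : s.val + τ < T) (ht : t.val + τ < T),
    s < t → 1 ≤ τ →
    ∀ Ks Kt : Kernel ℝ ℝ,
      IsDisint Q s ⟨s.val + τ, hs⟩ Ks → IsDisint Q t ⟨t.val + τ, ht⟩ Kt →
      ∀ᵐ x ∂(absPart (marginal Q s) (marginal Q t)), Ks x = Kt x


/-- Assumption (A) with fixed bounded continuous density versions: for all
`s, t ∈ {1,…,T}` a finite Borel measure `θ^{s,t}` equivalent to `μ_t^{μ_s,abs}`, together
with bounded continuous versions `ρs = dθ^{s,t}/dμ_s` and `ρt = dθ^{s,t}/dμ_t` of the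
Radon–Nikodym derivatives. -/
structure DensitySystem {T : ℕ} (μ : Fin T → Measure ℝ) where
  θ : Fin T → Fin T → Measure ℝ
  ρs : Fin T → Fin T → ℝ → ℝ
  ρt : Fin T → Fin T → ℝ → ℝ
  finite : ∀ s t, IsFiniteMeasure (θ s t)
  ac : ∀ s t, θ s t ≪ absPart (μ t) (μ s)
  ac' : ∀ s t, absPart (μ t) (μ s) ≪ θ s t
  conts : ∀ s t, Continuous (ρs s t)
  contt : ∀ s t, Continuous (ρt s t)
  bdds : ∀ s t, ∃ C, ∀ x, |ρs s t x| ≤ C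
  bddt : ∀ s t, ∃ C, ∀ x, |ρt s t x| ≤ C
  denss : ∀ s t, θ s t = (μ s).withDensity (fun x => ENNReal.ofReal (ρs s t x))
  denst : ∀ s t, θ s t = (μ t).withDensity (fun x => ENNReal.ofReal (ρt s t x))

/-- `Q` is an `r`-homogeneous coupling w.r.t. the divergence `Dist`:
`Dist(θ^{s,t} ⊗ K_{s,s+τ}, θ^{s,t} ⊗ K_{t,t+τ}) ≤ r_{s,t,τ}` for all `(s,t,τ) ∈ Δ`. -/
def IsRHom {T : ℕ} {μ : Fin T → Measure ℝ} (D : DensitySystem μ)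
    (Dist : Measure (ℝ × ℝ) → Measure (ℝ × ℝ) → ℝ≥0∞)
    (r : Fin T → Fin T → ℕ → ℝ) (Q : Measure (Fin T → ℝ)) : Prop :=
  ∀ (s t : Fin T) (τ : ℕ) (hs : s.val + τ < T) (ht : t.val + τ < T),
    s < t → 1 ≤ τ →
    ∀ Ks Kt : Kernel ℝ ℝ,
      IsDisint Q s ⟨s.val + τ, hs⟩ Ks → IsDisint Q t ⟨t.val + τ, ht⟩ Kt →
      Dist ((D.θ s t).compProd Ks) ((D.θ s t).compProd Kt) ≤ ENNReal.ofReal (r s t τ)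

lemma aux_wd (μ : Measure ℝ) [IsProbabilityMeasure μ] (f : ℝ → ℝ≥0∞) (hf : Measurable f)
    [SFinite (μ.withDensity f)] (K : Kernel ℝ ℝ) [IsMarkovKernel K] :
    (μ.withDensity f).compProd K = (μ.compProd K).withDensity (fun p => f p.1) := by
  ext A hA
  rw [Measure.compProd_apply hA, withDensity_apply _ hA, ← lintegral_indicator hA,
    Measure.lintegral_compProd (by fun_prop (disch := assumption)),
    lintegral_withDensity_eq_lintegral_mul _ hf (Kernel.measurable_kernel_prodMk_left hA)]
  refine lintegral_congr fun x => ?_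
  have : (fun y => A.indicator (fun p : ℝ × ℝ => f p.1) (x, y))
      = (Prod.mk x ⁻¹' A).indicator (fun _ => f x) := by
    ext y; simp only [Set.indicator]; rfl
  rw [this, lintegral_indicator (measurable_prodMk_left hA)]
  simp

lemma aux_exists {T : ℕ} (Q : Measure (Fin T → ℝ)) [IsProbabilityMeasure Q] (s u : Fin T) :
    ∃ K, IsDisint Q s u K := by
  have hm : Measurable (fun x : Fin T → ℝ => (x s, x u)) := by fun_prop
  have : IsProbabilityMeasure (joint Q s u) := Measure.isProbabilityMeasure_map hm.aemeasurable
  refine ⟨(joint Q s u).condKernel, inferInstance, ?_⟩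
  have h : marginal Q s = (joint Q s u).fst := by
    rw [Measure.fst, joint, Measure.map_map measurable_fst hm]; rfl
  rw [h]
  exact ((joint Q s u).disintegrate _).symm

lemma aux_marg {T : ℕ} (Qa Qb : Measure (Fin T → ℝ)) (a b : ℝ≥0∞) (t : Fin T) :
    marginal (a • Qa + b • Qb) t = a • marginal Qa t + b • marginal Qb t := by
  unfold marginal
  rw [Measure.map_add _ _ (by fun_prop), Measure.map_smul, Measure.map_smul]

lemma aux_joint {T : ℕ} (Qa Qb : Measure (Fin T → ℝ)) (a b : ℝ≥0∞) (s t : Fin T) :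
    joint (a • Qa + b • Qb) s t = a • joint Qa s t + b • joint Qb s t := by
  unfold joint
  rw [Measure.map_add _ _ (by fun_prop), Measure.map_smul, Measure.map_smul]

lemma aux_key {T : ℕ} (Qa Qb : Measure (Fin T → ℝ)) (a b : ℝ≥0∞) (s u : Fin T)
    (μ : Measure ℝ) [IsProbabilityMeasure μ]
    (ha : marginal Qa s = μ) (hb : marginal Qb s = μ) (hm : marginal (a • Qa + b • Qb) s = μ)
    (K Ka Kb : Kernel ℝ ℝ) (hK : IsDisint (a • Qa + b • Qb) s u K)
    (hKa : IsDisint Qa s u Ka) (hKb : IsDisint Qb s u Kb)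
    (θ : Measure ℝ) [IsFiniteMeasure θ] (f : ℝ → ℝ≥0∞) (hf : Measurable f)
    (hθ : θ = μ.withDensity f) :
    θ.compProd K = a • θ.compProd Ka + b • θ.compProd Kb := by
  obtain ⟨_, h⟩ := hK
  obtain ⟨_, h1⟩ := hKa
  obtain ⟨_, h2⟩ := hKb
  rw [aux_joint, hm, h1, h2, ha, hb] at h
  subst hθ
  rw [aux_wd μ f hf, aux_wd μ f hf, aux_wd μ f hf, ← h, withDensity_add_measure,
    withDensity_smul_measure, withDensity_smul_measure]

/-- for a jointly convex divergence `Dist` with values in `[0,∞]`, the set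
of `r`-homogeneous couplings of `μ_1,…,μ_T` is convex. -/
theorem r_hom_convex
    {T : ℕ} (hT : 2 ≤ T) (μ : Fin T → Measure ℝ)
    (hprob : ∀ t, IsProbabilityMeasure (μ t))
    (hmom : ∀ t, Integrable (fun x : ℝ => x) (μ t))
    (D : DensitySystem μ)
    (Dist : Measure (ℝ × ℝ) → Measure (ℝ × ℝ) → ℝ≥0∞)
    (hconv : ∀ (ν ν' ρ ρ' : Measure (ℝ × ℝ)) (l : ℝ), 0 < l → l < 1 →
      Dist (ENNReal.ofReal l • ν + ENNReal.ofReal (1 - l) • ν')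
           (ENNReal.ofReal l • ρ + ENNReal.ofReal (1 - l) • ρ')
        ≤ ENNReal.ofReal l * Dist ν ρ + ENNReal.ofReal (1 - l) * Dist ν' ρ')
    (r : Fin T → Fin T → ℕ → ℝ) (hr : ∀ s t τ, 0 ≤ r s t τ)
    (Qa Qb : Measure (Fin T → ℝ)) [IsProbabilityMeasure Qa] [IsProbabilityMeasure Qb]
    (hma : ∀ t, marginal Qa t = μ t) (hmb : ∀ t, marginal Qb t = μ t)
    (hra : IsRHom D Dist r Qa) (hrb : IsRHom D Dist r Qb)
    (l : ℝ) (hl0 : 0 < l) (hl1 : l < 1) :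
    (∀ t, marginal (ENNReal.ofReal l • Qa + ENNReal.ofReal (1 - l) • Qb) t = μ t) ∧
    IsRHom D Dist r (ENNReal.ofReal l • Qa + ENNReal.ofReal (1 - l) • Qb) := by
  have hsum : ENNReal.ofReal l + ENNReal.ofReal (1 - l) = 1 := by
    rw [← ENNReal.ofReal_add hl0.le (by linarith)]; simp
  have hm : ∀ t, marginal (ENNReal.ofReal l • Qa + ENNReal.ofReal (1 - l) • Qb) t = μ t := by
    intro t
    rw [aux_marg, hma, hmb, ← add_smul, hsum, one_smul]
  refine ⟨hm, ?_⟩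
  intro s t τ hs ht hst hτ Ks Kt hKs hKt
  obtain ⟨Kas, hKas⟩ := aux_exists Qa s ⟨s.val + τ, hs⟩
  obtain ⟨Kat, hKat⟩ := aux_exists Qa t ⟨t.val + τ, ht⟩
  obtain ⟨Kbs, hKbs⟩ := aux_exists Qb s ⟨s.val + τ, hs⟩
  obtain ⟨Kbt, hKbt⟩ := aux_exists Qb t ⟨t.val + τ, ht⟩
  have := D.finite s t
  have := hprob s
  have := hprob t
  rw [aux_key Qa Qb _ _ s _ (μ s) (hma s) (hmb s) (hm s) Ks Kas Kbs hKs hKas hKbs (D.θ s t) _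
      (D.conts s t).measurable.ennreal_ofReal (D.denss s t),
    aux_key Qa Qb _ _ t _ (μ t) (hma t) (hmb t) (hm t) Kt Kat Kbt hKt hKat hKbt (D.θ s t) _
      (D.contt s t).measurable.ennreal_ofReal (D.denst s t)]
  refine (hconv _ _ _ _ l hl0 hl1).trans ?_
  calc _ ≤ ENNReal.ofReal l * ENNReal.ofReal (r s t τ)
        + ENNReal.ofReal (1 - l) * ENNReal.ofReal (r s t τ) := by
        gcongr
        · exact hra s t τ hs ht hst hτ _ _ hKas hKat
        · exact hrb s t τ hs ht hst hτ _ _ hKbs hKbt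
    _ = _ := by rw [← add_mul, hsum, one_mul]
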